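/- Let m ≥ 2 be an integer, q complex with 0 < |q| < 1, and x_1,…,x_{m−1} complex numbers. With K_m^{(0)}(x_1,…,x_{m−1}) = Σ_{c_1,…,c_{m−1}=0}^{∞} (−1)^{c_{m−1}} q^{c_{m−1}(c_{m−1}+1)/2} x_{m−1}^{c_{m−1}} Π_{i=1}^{m−2} q^{c_i²+c_i} x_i^{c_i} [c_{i+1} choose c_i]_q, and K_m^{(m−2)} the multivariate series in which the slot m−2 carries the factor q^{c_{m−2}²} x_{m−2}^{c_{m−2}} [c_{m−1}+1 choose c_{m−2}]_q and slots i < m−2 carry q^{c_i²} x_i^{c_i} [c_{i+1} choose c_i]_q, the identity K_m^{(0)}(x_1,…,x_{m−1}) = 1 − q·x_{m−1} · K_m^{(m−2)}(q·x_1,…,q·x_{m−1}) holds. -/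

import Mathlib

open scoped BigOperators

/-- The Gaussian binomial coefficient `[M choose n]_q`: equal to
`(q)_M/((q)_n (q)_{M−n})` for `M ≥ n ≥ 0` and to `0` otherwise; defined via the
`q`-Pascal recursion (hence an integer polynomial in `q`). -/
def qBinom (q : ℂ) : ℕ → ℕ → ℂ
  | _, 0 => 1
  | 0, _ + 1 => 0
  | M + 1, n + 1 => q ^ (n + 1) * qBinom q M (n + 1) + qBinom q M n

/-- General term of the multivariate series `K_m^{(a)}(x_1,…,x_{m−1})` with `m = p+2`,
summed over `c : Fin (p+1) → ℕ` (`c j` is `c_{j+1}`): the last slot contributes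
`(−1)^{c_{m−1}} q^{c_{m−1}(c_{m−1}+1)/2} x_{m−1}^{c_{m−1}}`, slot `i` for `1 ≤ i ≤ a−1`
(resp. `i = a`, resp. `a+1 ≤ i ≤ m−2`) contributes `q^{c_i²} x_i^{c_i} [c_{i+1} choose c_i]_q`
(resp. `q^{c_a²} x_a^{c_a} [c_{a+1}+1 choose c_a]_q`, resp.
`q^{c_i²+c_i} x_i^{c_i} [c_{i+1} choose c_i]_q`); for `a = 0` all slots
`1 ≤ i ≤ m−2` carry `q^{c_i²+c_i} x_i^{c_i} [c_{i+1} choose c_i]_q`. -/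
noncomputable def KtermM (p a : ℕ) (q : ℂ) (x : Fin (p + 1) → ℂ)
    (c : Fin (p + 1) → ℕ) : ℂ :=
  (-1 : ℂ) ^ (c (Fin.last p)) *
    q ^ ((c (Fin.last p) * (c (Fin.last p) + 1)) / 2) *
    (x (Fin.last p)) ^ (c (Fin.last p)) *
    ∏ j : Fin p,
      q ^ ((c j.castSucc) ^ 2 + (if a ≤ (j : ℕ) then c j.castSucc else 0)) *
        (x j.castSucc) ^ (c j.castSucc) *
        qBinom q (c j.succ + (if (j : ℕ) + 1 = a then 1 else 0)) (c j.castSucc)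

theorem qBinom_eq_zero_of_lt (q : ℂ) {M n : ℕ} (h : M < n) : qBinom q M n = 0 := by
  induction M generalizing n with
  | zero =>
    obtain ⟨k, rfl⟩ := Nat.exists_eq_succ_of_ne_zero h.ne'
    simp [qBinom]
  | succ M ih =>
    obtain ⟨k, rfl⟩ := Nat.exists_eq_succ_of_ne_zero (by omega : n ≠ 0)
    simp [qBinom, ih (by omega : M < k + 1), ih (by omega : M < k)]

theorem qBinom_zero_right (q : ℂ) (M : ℕ) : qBinom q M 0 = 1 := by
  cases M <;> simp [qBinom]

theorem norm_qBinom_le {q : ℂ} (hq : ‖q‖ ≤ 1) (M n : ℕ) : ‖qBinom q M n‖ ≤ 2 ^ M := by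
  induction M generalizing n with
  | zero => cases n <;> simp [qBinom]
  | succ M ih =>
    cases n with
    | zero => simpa [qBinom] using one_le_pow₀ (M₀ := ℝ) one_le_two (n := M + 1)
    | succ n =>
      calc ‖qBinom q (M + 1) (n + 1)‖
          ≤ ‖q ^ (n + 1) * qBinom q M (n + 1)‖ + ‖qBinom q M n‖ := by
            simpa only [qBinom] using norm_add_le _ _
        _ ≤ 1 * 2 ^ M + 2 ^ M := by
            rw [norm_mul, norm_pow]
            gcongr
            · exact pow_le_one₀ (norm_nonneg _) hq
            · exact ih _
            · exact ih _
        _ = 2 ^ (M + 1) := by ring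

theorem triangle_succ (n : ℕ) : (n + 1) * (n + 1 + 1) / 2 = n * (n + 1) / 2 + (n + 1) := by
  rw [show (n + 1) * (n + 1 + 1) = n * (n + 1) + (n + 1) * 2 by ring,
    Nat.add_mul_div_right _ _ two_pos]

theorem summable_pow_triangle_mul_pow {r : ℝ} (hr0 : 0 < r) (hr1 : r < 1) {y : ℝ} (hy : 0 ≤ y) :
    Summable fun n : ℕ => r ^ (n * (n + 1) / 2) * y ^ n := by
  rcases hy.eq_or_lt with rfl | hy
  · refine summable_of_ne_finset_zero (s := {0}) fun n hn => ?_
    simp [zero_pow (by simpa using hn : n ≠ 0)]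
  refine summable_of_ratio_test_tendsto_lt_one zero_lt_one
    (Filter.Eventually.of_forall fun n => by positivity) ?_
  have h : Filter.Tendsto (fun n : ℕ => r ^ (n + 1) * y) Filter.atTop (nhds 0) := by
    simpa using ((Filter.tendsto_add_atTop_iff_nat 1).2
      (tendsto_pow_atTop_nhds_zero_of_lt_one hr0.le hr1)).mul_const y
  refine h.congr fun n => ?_
  rw [Real.norm_of_nonneg (by positivity), Real.norm_of_nonneg (by positivity),
    triangle_succ, pow_add, pow_succ y]
  field_simp
  ring

theorem summable_prod_fin {n : ℕ} {g : Fin n → ℕ → ℝ} (h0 : ∀ j k, 0 ≤ g j k)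
    (hg : ∀ j, Summable (g j)) : Summable fun c : Fin n → ℕ => ∏ j, g j (c j) := by
  induction n with
  | zero => exact (hasSum_fintype _).summable
  | succ n ih =>
    have h := (hg 0).mul_of_nonneg (ih (fun j => h0 j.succ) fun j => hg j.succ) (h0 0)
      (fun c => Finset.prod_nonneg fun j _ => h0 _ _)
    rw [← (Fin.consEquiv fun _ => ℕ).summable_iff]
    refine h.congr fun c => ?_
    simp [Fin.prod_univ_succ, Fin.consEquiv]

theorem norm_KtermM_zero_le {p : ℕ} {q : ℂ} (hq : ‖q‖ ≤ 1) (x : Fin (p + 1) → ℂ)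
    (c : Fin (p + 1) → ℕ) :
    ‖KtermM p 0 q x c‖ ≤ ∏ j, (‖q‖ ^ (c j * (c j + 1) / 2) * (2 * ‖x j‖) ^ c j) := by
  have h1 : ‖KtermM p 0 q x c‖ ≤ ‖q‖ ^ (c (Fin.last p) * (c (Fin.last p) + 1) / 2) *
      ‖x (Fin.last p)‖ ^ c (Fin.last p) *
      ∏ j : Fin p, (‖q‖ ^ (c j.castSucc * (c j.castSucc + 1) / 2) *
        ‖x j.castSucc‖ ^ c j.castSucc * 2 ^ c j.succ) := by
    simp only [KtermM, norm_mul, norm_pow, norm_neg, norm_one, one_pow, one_mul, norm_prod]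
    refine mul_le_mul_of_nonneg_left (Finset.prod_le_prod (fun _ _ => by positivity)
      fun j _ => mul_le_mul (mul_le_mul_of_nonneg_right ?_ (by positivity)) ?_
        (norm_nonneg _) (by positivity)) (by positivity)
    · refine pow_le_pow_of_le_one (norm_nonneg _) hq ?_
      simp only [Nat.zero_le, if_true]
      refine (Nat.div_le_self _ _).trans (le_of_eq (by ring))
    · simpa using norm_qBinom_le hq (c j.succ) (c j.castSucc)
  have h2 : ∏ j : Fin p, (2 : ℝ) ^ c j.succ ≤ ∏ j, (2 : ℝ) ^ c j := by
    rw [Fin.prod_univ_succ]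
    exact le_mul_of_one_le_left (by positivity) (one_le_pow₀ one_le_two)
  refine h1.trans ?_
  simp only [mul_pow, Finset.prod_mul_distrib]
  rw [Fin.prod_univ_castSucc (fun j => ‖q‖ ^ (c j * (c j + 1) / 2)),
    Fin.prod_univ_castSucc (fun j => ‖x j‖ ^ c j)]
  refine le_trans (le_of_eq ?_) (mul_le_mul_of_nonneg_left
    (mul_le_mul_of_nonneg_right h2 (by positivity)) (by positivity))
  ring

theorem summable_KtermM_zero {p : ℕ} {q : ℂ} (hq0 : q ≠ 0) (hq1 : ‖q‖ < 1)
    (x : Fin (p + 1) → ℂ) : Summable (KtermM p 0 q x) :=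
  Summable.of_norm_bounded
    (summable_prod_fin (fun _ _ => by positivity) fun _ =>
      summable_pow_triangle_mul_pow (norm_pos_iff.2 hq0) hq1 (by positivity))
    (norm_KtermM_zero_le hq1.le x)

theorem KtermM_zero_of_last_eq_zero {p : ℕ} (q : ℂ) (x : Fin (p + 1) → ℂ)
    {c : Fin (p + 1) → ℕ} (hc : c (Fin.last p) = 0) :
    KtermM p 0 q x c = if c = 0 then 1 else 0 := by
  split_ifs with h
  · subst h
    simp [KtermM, qBinom_zero_right]
  · obtain ⟨j, hj⟩ : ∃ j : Fin p, c j.succ < c j.castSucc := by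
      by_contra! hmono
      refine h (funext fun j => ?_)
      have := Fin.monotone_iff_le_succ.2 hmono (Fin.le_last j)
      simpa [hc] using this
    refine mul_eq_zero_of_right _ (Finset.prod_eq_zero (Finset.mem_univ j) ?_)
    simp [qBinom_eq_zero_of_lt q hj]

/-- Increase the last entry of a tuple of natural numbers by one. -/
def succLast {p : ℕ} (c : Fin (p + 1) → ℕ) : Fin (p + 1) → ℕ :=
  fun j => c j + if j = Fin.last p then 1 else 0

theorem succLast_injective {p : ℕ} : Function.Injective (succLast (p := p)) :=
  fun _ _ h => funext fun j => Nat.add_right_cancel (congrFun h j)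

theorem last_eq_zero_of_notMem_range_succLast {p : ℕ} {c : Fin (p + 1) → ℕ}
    (hc : c ∉ Set.range succLast) : c (Fin.last p) = 0 := by
  by_contra h
  refine hc ⟨fun j => c j - if j = Fin.last p then 1 else 0, funext fun j => ?_⟩
  by_cases hj : j = Fin.last p
  · subst hj
    simp only [succLast, if_true]
    omega
  · simp [succLast, hj]

theorem KtermM_zero_succLast {p : ℕ} (q : ℂ) (x : Fin (p + 1) → ℂ) (c : Fin (p + 1) → ℕ) :
    KtermM p 0 q x (succLast c) =
      -(q * x (Fin.last p)) * KtermM p p q (fun j => q * x j) c := by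
  have hprod : ∀ j : Fin p,
      q ^ ((succLast c j.castSucc) ^ 2 + (if 0 ≤ (j : ℕ) then succLast c j.castSucc else 0)) *
        (x j.castSucc) ^ (succLast c j.castSucc) *
        qBinom q (succLast c j.succ + (if (j : ℕ) + 1 = 0 then 1 else 0))
          (succLast c j.castSucc) =
      q ^ ((c j.castSucc) ^ 2 + (if p ≤ (j : ℕ) then c j.castSucc else 0)) *
        (q * x j.castSucc) ^ (c j.castSucc) *
        qBinom q (c j.succ + (if (j : ℕ) + 1 = p then 1 else 0)) (c j.castSucc) := by
    intro j
    have h1 : succLast c j.castSucc = c j.castSucc := by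
      simp [succLast, (Fin.castSucc_lt_last j).ne]
    have h2 : succLast c j.succ = c j.succ + if (j : ℕ) + 1 = p then 1 else 0 := by
      simp [succLast, Fin.ext_iff]
    rw [h1, h2]
    simp only [Nat.zero_le, if_true, not_le.2 j.isLt, if_false, Nat.succ_ne_zero, add_zero]
    ring
  have hlast : succLast c (Fin.last p) = c (Fin.last p) + 1 := by simp [succLast]
  simp only [KtermM]
  rw [Finset.prod_congr rfl fun j _ => hprod j, hlast, triangle_succ]
  ring

/-- for `m ≥ 2` (`m = p+2`), `0 < |q| < 1` and arbitrary
`x_1,…,x_{m−1} : ℂ`, the identity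
`K_m^{(0)}(x_1,…,x_{m−1}) = 1 − q x_{m−1} K_m^{(m−2)}(q x_1,…,q x_{m−1})` holds
(for `m = 2` this reads `K_2^{(0)}(x) = 1 − q x K_2^{(0)}(q x)`). -/
theorem stmt6 (m p : ℕ) (hm : m = p + 2) (q : ℂ) (hq0 : q ≠ 0) (hq1 : ‖q‖ < 1)
    (x : Fin (p + 1) → ℂ) :
    HasSum (fun c : Fin (p + 1) → ℕ => KtermM p 0 q x c)
      (1 - q * x (Fin.last p) *
        ∑' c : Fin (p + 1) → ℕ, KtermM p p q (fun j => q * x j) c) := by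
  have hf := summable_KtermM_zero hq0 hq1 x
  have h1 : HasSum (fun c => KtermM p 0 q x c - if c = 0 then 1 else 0)
      (-(q * x (Fin.last p)) * ∑' c, KtermM p p q (fun j => q * x j) c) := by
    rw [← succLast_injective.hasSum_iff fun c hc => by
      rw [KtermM_zero_of_last_eq_zero q x (last_eq_zero_of_notMem_range_succLast hc), sub_self],
      ← tsum_mul_left]
    have h := (hf.comp_injective succLast_injective).hasSum
    simp only [Function.comp_def, KtermM_zero_succLast] at h
    refine h.congr_fun fun c => ?_
    have hc : succLast c ≠ 0 := fun h0 => by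
      simpa [succLast] using congrFun h0 (Fin.last p)
    simp [KtermM_zero_succLast, hc]
  have h2 := (hasSum_ite_eq (0 : Fin (p + 1) → ℕ) (1 : ℂ)).add h1
  convert h2 using 1
  · ext c
    ring
  · ring
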